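/- arXiv:2103.15213 — 3 statements merged into one kernel-verified Lean document; each statement's English description precedes it below -/
import Mathlib

section
/- Assume μ has finite second moment σ_p² = E_{(Ω1, Ω2) ∼ μ}[‖Ω1‖² + ‖Ω2‖²], and let the m pairs (ω_{1,i}, ω_{2,i}) be sampled i.i.d. from μ. Then for every fixed (z, z') ∈ ℝ^D × ℝ^D, the approximation error Δ(z, z') = ⟨φ(z), φ(z')⟩ − K_μ(z, z') is differentiable in (z, z') and E[ ‖∇_{(z, z')} Δ(z, z')‖² ] ≤ 8 σ_p², where ∇_{(z, z')} denotes the gradient with respect to the joint variable (z, z') ∈ ℝ^{2D}. -/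
open MeasureTheory Real
open scoped RealInnerProductSpace BigOperators

/-- The symmetrized spectral integrand
`ψ(z, z'; ω) = (1/4)(cos⟨z − z', ω₁⟩ + cos(⟨z, ω₁⟩ − ⟨z', ω₂⟩)
              + cos(⟨z, ω₂⟩ − ⟨z', ω₁⟩) + cos⟨z − z', ω₂⟩)`. -/
noncomputable def specPsi {E : Type*} [NormedAddCommGroup E] [InnerProductSpace ℝ E]
    (z z' : E) (ω : E × E) : ℝ :=
  (1 / 4) * (Real.cos ⟪z - z', ω.1⟫ + Real.cos (⟪z, ω.1⟫ - ⟪z', ω.2⟫)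
    + Real.cos (⟪z, ω.2⟫ - ⟪z', ω.1⟫) + Real.cos ⟪z - z', ω.2⟫)

/-- The symmetrized spectral kernel `K_μ(z, z') = E_{(Ω₁,Ω₂) ∼ μ}[ψ(z, z'; (Ω₁,Ω₂))]`. -/
noncomputable def specKernel {E : Type*} [NormedAddCommGroup E] [InnerProductSpace ℝ E]
    [MeasurableSpace E] (μ : Measure (E × E)) (z z' : E) : ℝ :=
  ∫ ω, specPsi z z' ω ∂μ

/-- The random feature map `φ : ℝ^D → ℝ^{2m}` built from `m` sample pairs
`(ω_{1,i}, ω_{2,i})`; the coordinate `(i, false)` is the cosine feature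
`(1/(2√m))(cos⟨z, ω_{1,i}⟩ + cos⟨z, ω_{2,i}⟩)` and `(i, true)` the sine feature
`(1/(2√m))(sin⟨z, ω_{1,i}⟩ + sin⟨z, ω_{2,i}⟩)`. -/
noncomputable def featMap {E : Type*} [NormedAddCommGroup E] [InnerProductSpace ℝ E]
    {m : ℕ} (ω : Fin m → E × E) (z : E) : EuclideanSpace ℝ (Fin m × Bool) :=
  (EuclideanSpace.equiv (Fin m × Bool) ℝ).symm fun p =>
    if p.2 then
      (1 / (2 * Real.sqrt m)) * (Real.sin ⟪z, (ω p.1).1⟫ + Real.sin ⟪z, (ω p.1).2⟫)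
    else
      (1 / (2 * Real.sqrt m)) * (Real.cos ⟪z, (ω p.1).1⟫ + Real.cos ⟪z, (ω p.1).2⟫)

section SpectralKernel

variable {E : Type*} [NormedAddCommGroup E] [InnerProductSpace ℝ E]

lemma specPsi_comm (z z' : E) (ω : E × E) : specPsi z z' ω = specPsi z' z ω := by
  simp only [specPsi]
  rw [← Real.cos_neg ⟪z - z', ω.1⟫, ← Real.cos_neg ⟪z - z', ω.2⟫,
    ← Real.cos_neg (⟪z, ω.1⟫ - ⟪z', ω.2⟫), ← Real.cos_neg (⟪z, ω.2⟫ - ⟪z', ω.1⟫)]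
  simp only [← inner_neg_left, neg_sub]
  ring

lemma abs_specPsi_le_one (z z' : E) (ω : E × E) : |specPsi z z' ω| ≤ 1 := by
  have h := fun x => abs_le.1 (Real.abs_cos_le_one x)
  simp only [specPsi]
  rw [abs_le]
  constructor <;>
    linarith [h ⟪z - z', ω.1⟫, h (⟪z, ω.1⟫ - ⟪z', ω.2⟫), h (⟪z, ω.2⟫ - ⟪z', ω.1⟫),
      h ⟪z - z', ω.2⟫]

lemma abs_specPsi_sub_left_le (x y z' : E) (ω : E × E) :
    |specPsi x z' ω - specPsi y z' ω| ≤ (‖ω.1‖ + ‖ω.2‖) / 2 * ‖x - y‖ := by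
  have key (v : E) (c : ℝ) :
      |Real.cos (⟪x, v⟫ - c) - Real.cos (⟪y, v⟫ - c)| ≤ ‖v‖ * ‖x - y‖ := by
    refine (Real.abs_cos_sub_cos_le _ _).trans ?_
    rw [sub_sub_sub_cancel_right, ← inner_sub_left, mul_comm]
    exact abs_real_inner_le_norm _ _
  have h₁ := abs_le.1 (key ω.1 ⟪z', ω.1⟫)
  have h₂ := abs_le.1 (key ω.1 ⟪z', ω.2⟫)
  have h₃ := abs_le.1 (key ω.2 ⟪z', ω.1⟫)
  have h₄ := abs_le.1 (key ω.2 ⟪z', ω.2⟫)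
  simp only [specPsi, inner_sub_left]
  rw [abs_le]
  constructor <;> linarith

lemma abs_specPsi_sub_le (p q : E × E) (ω : E × E) :
    |specPsi p.1 p.2 ω - specPsi q.1 q.2 ω| ≤ (‖ω.1‖ + ‖ω.2‖) * ‖p - q‖ := by
  have h₁ := abs_specPsi_sub_left_le p.1 q.1 p.2 ω
  have h₂ := abs_specPsi_sub_left_le p.2 q.2 q.1 ω
  rw [specPsi_comm p.2, specPsi_comm q.2] at h₂
  have h₃ : ‖p.1 - q.1‖ ≤ ‖p - q‖ := norm_fst_le (p - q)
  have h₄ : ‖p.2 - q.2‖ ≤ ‖p - q‖ := norm_snd_le (p - q)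
  have h₀ : 0 ≤ (‖ω.1‖ + ‖ω.2‖) / 2 := by positivity
  have := abs_sub_le (specPsi p.1 p.2 ω) (specPsi q.1 p.2 ω) (specPsi q.1 q.2 ω)
  nlinarith [mul_le_mul_of_nonneg_left h₃ h₀, mul_le_mul_of_nonneg_left h₄ h₀]

lemma contDiff_specPsi : ContDiff ℝ 1 fun x : (E × E) × E × E => specPsi x.2.1 x.2.2 x.1 := by
  have h {f g : (E × E) × E × E → E} (hf : ContDiff ℝ 1 f) (hg : ContDiff ℝ 1 g) :
      ContDiff ℝ 1 fun x => ⟪f x, g x⟫ := hf.inner ℝ hg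
  refine contDiff_const.mul (.add (.add (.add ?_ ?_) ?_) ?_)
  · exact (h (by fun_prop) (by fun_prop)).cos
  · exact ((h (by fun_prop) (by fun_prop)).sub (h (by fun_prop) (by fun_prop))).cos
  · exact ((h (by fun_prop) (by fun_prop)).sub (h (by fun_prop) (by fun_prop))).cos
  · exact (h (by fun_prop) (by fun_prop)).cos

lemma differentiable_specPsi (ω : E × E) :
    Differentiable ℝ fun p : E × E => specPsi p.1 p.2 ω :=
  (contDiff_specPsi.comp (by fun_prop : ContDiff ℝ 1 fun p : E × E => (ω, p))).differentiable
    one_ne_zero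

lemma inner_featMap {m : ℕ} (ω : Fin m → E × E) (z z' : E) :
    ⟪featMap ω z, featMap ω z'⟫ = (∑ i, specPsi z z' (ω i)) / m := by
  rw [PiLp.inner_apply, Fintype.sum_prod_type, Finset.sum_div]
  refine Finset.sum_congr rfl fun i _ => ?_
  have hs : ((1 : ℝ) / (2 * √m)) ^ 2 = 1 / 4 / m := by
    rw [div_pow, mul_pow, Real.sq_sqrt m.cast_nonneg]
    ring
  simp only [featMap, specPsi, Fintype.sum_bool, inner_sub_left, Real.cos_sub,
    EuclideanSpace.equiv, PiLp.continuousLinearEquiv_symm_apply, RCLike.inner_apply, conj_trivial,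
    if_true, Bool.false_eq_true, if_false]
  linear_combination ((Real.sin ⟪z, (ω i).1⟫ + Real.sin ⟪z, (ω i).2⟫)
    * (Real.sin ⟪z', (ω i).1⟫ + Real.sin ⟪z', (ω i).2⟫)
    + (Real.cos ⟪z, (ω i).1⟫ + Real.cos ⟪z, (ω i).2⟫)
    * (Real.cos ⟪z', (ω i).1⟫ + Real.cos ⟪z', (ω i).2⟫)) * hs

variable [MeasurableSpace E] {μ : Measure (E × E)}

lemma specKernel_comm (z z' : E) : specKernel μ z z' = specKernel μ z' z := by
  simp only [specKernel, specPsi_comm z z']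

variable [BorelSpace E] [FiniteDimensional ℝ E]

lemma integrable_specPsi [IsFiniteMeasure μ] (z z' : E) : Integrable (specPsi z z') μ := by
  have := FiniteDimensional.proper_real E
  refine .of_bound (C := 1) ?_ (.of_forall fun ω => abs_specPsi_le_one z z' ω)
  exact (contDiff_specPsi.continuous.comp
    (by fun_prop : Continuous fun ω : E × E => (ω, z, z'))).aestronglyMeasurable

lemma differentiable_specKernel [IsFiniteMeasure μ]
    (hμ : Integrable (fun ω : E × E => ‖ω.1‖ + ‖ω.2‖) μ) :
    Differentiable ℝ fun p : E × E => specKernel μ p.1 p.2 := by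
  have := FiniteDimensional.proper_real E
  intro p
  refine (hasFDerivAt_integral_of_dominated_loc_of_lip'
    (F := fun (p : E × E) ω => specPsi p.1 p.2 ω)
    (F' := fun ω => fderiv ℝ (fun q : E × E => specPsi q.1 q.2 ω) p)
    Filter.univ_mem (fun x _ => (integrable_specPsi x.1 x.2).aestronglyMeasurable)
    (integrable_specPsi p.1 p.2) ?_ (.of_forall fun ω x _ => abs_specPsi_sub_le x p ω) hμ
    (.of_forall fun ω => ?_)).2.differentiableAt
  · exact (ContDiff.fderiv (m := 1) (n := 0) (f := fun (ω q : E × E) => specPsi q.1 q.2 ω)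
      (g := fun _ => p) contDiff_specPsi contDiff_const (by simp)).continuous
      |>.aestronglyMeasurable
  · exact (differentiable_specPsi ω p).hasFDerivAt

lemma abs_specKernel_sub_left_le [IsFiniteMeasure μ]
    (hμ : Integrable (fun ω : E × E => ‖ω.1‖ + ‖ω.2‖) μ) (x y z' : E) :
    |specKernel μ x z' - specKernel μ y z'| ≤ (∫ ω, (‖ω.1‖ + ‖ω.2‖) / 2 ∂μ) * ‖x - y‖ := by
  simp only [specKernel]
  rw [← integral_sub (integrable_specPsi _ _) (integrable_specPsi _ _), ← integral_mul_const]
  rw [← Real.norm_eq_abs]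
  exact norm_integral_le_of_norm_le ((hμ.div_const 2).mul_const _)
    (.of_forall fun ω => abs_specPsi_sub_left_le x y z' ω)

lemma integrable_norm_add_norm [IsFiniteMeasure μ]
    (hμ : Integrable (fun ω : E × E => ‖ω.1‖ ^ 2 + ‖ω.2‖ ^ 2) μ) :
    Integrable (fun ω : E × E => ‖ω.1‖ + ‖ω.2‖) μ := by
  have := FiniteDimensional.proper_real E
  refine (hμ.add (integrable_const 1)).mono'
    (by fun_prop : Continuous fun ω : E × E => ‖ω.1‖ + ‖ω.2‖).aestronglyMeasurable
    (.of_forall fun ω => ?_)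
  rw [Real.norm_of_nonneg (by positivity)]
  simp only [Pi.add_apply]
  nlinarith [sq_nonneg (‖ω.1‖ - 1 / 2), sq_nonneg (‖ω.2‖ - 1 / 2)]

lemma sq_integral_half_norm_add_norm_le [IsProbabilityMeasure μ]
    (hμ : Integrable (fun ω : E × E => ‖ω.1‖ ^ 2 + ‖ω.2‖ ^ 2) μ) :
    (∫ ω, (‖ω.1‖ + ‖ω.2‖) / 2 ∂μ) ^ 2 ≤ (∫ ω, (‖ω.1‖ ^ 2 + ‖ω.2‖ ^ 2) ∂μ) / 2 := by
  set a := ∫ ω, (‖ω.1‖ + ‖ω.2‖) / 2 ∂μ with ha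
  have hb := (integrable_norm_add_norm hμ).div_const 2
  have h : ∫ ω, (2 * a * ((‖ω.1‖ + ‖ω.2‖) / 2) - a ^ 2) ∂μ
      ≤ ∫ ω, (‖ω.1‖ ^ 2 + ‖ω.2‖ ^ 2) / 2 ∂μ := by
    refine integral_mono ((hb.const_mul _).sub (integrable_const _)) (hμ.div_const 2) fun ω => ?_
    dsimp only
    nlinarith [sq_nonneg ((‖ω.1‖ + ‖ω.2‖) / 2 - a), sq_nonneg (‖ω.1‖ - ‖ω.2‖)]
  rw [integral_sub (hb.const_mul _) (integrable_const _), integral_const_mul, ← ha,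
    integral_div] at h
  simp only [integral_const, probReal_univ, one_smul] at h
  linarith

lemma norm_gradient_sq_le [IsProbabilityMeasure μ] {m : ℕ} (hm : 0 < m)
    (hμ : Integrable (fun ω : E × E => ‖ω.1‖ ^ 2 + ‖ω.2‖ ^ 2) μ) (ω : Fin m → E × E) (z z' : E) :
    ‖gradient (fun y => ⟪featMap ω y, featMap ω z'⟫ - specKernel μ y z') z‖ ^ 2
      ≤ (∑ i, (‖(ω i).1‖ ^ 2 + ‖(ω i).2‖ ^ 2)) / m
        + ∫ ω, (‖ω.1‖ ^ 2 + ‖ω.2‖ ^ 2) ∂μ := by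
  have hm' : (0 : ℝ) < m := Nat.cast_pos.2 hm
  set a := ∫ ω, (‖ω.1‖ + ‖ω.2‖) / 2 ∂μ with ha
  have ha₀ : 0 ≤ a := integral_nonneg fun ω => by positivity
  set b := (∑ i, (‖(ω i).1‖ + ‖(ω i).2‖) / 2) / m with hb
  have hb₀ : 0 ≤ b := by positivity
  have hgrad : ‖gradient (fun y => ⟪featMap ω y, featMap ω z'⟫ - specKernel μ y z') z‖ ≤ b + a := by
    rw [gradient, LinearIsometryEquiv.norm_map]
    refine norm_fderiv_le_of_lip' ℝ (by positivity) (.of_forall fun y => ?_)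
    rw [Real.norm_eq_abs, sub_sub_sub_comm, add_mul]
    refine (abs_sub _ _).trans (add_le_add ?_
      (abs_specKernel_sub_left_le (integrable_norm_add_norm hμ) y z z'))
    rw [inner_featMap, inner_featMap, ← sub_div, ← Finset.sum_sub_distrib, abs_div,
      Nat.abs_cast, hb, div_mul_eq_mul_div, Finset.sum_mul]
    gcongr
    exact (Finset.abs_sum_le_sum_abs _ _).trans
      (Finset.sum_le_sum fun i _ => abs_specPsi_sub_left_le y z z' (ω i))
  have hb_sq : b ^ 2 ≤ (∑ i, (‖(ω i).1‖ ^ 2 + ‖(ω i).2‖ ^ 2)) / m / 2 := by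
    have h : (∑ i, (‖(ω i).1‖ + ‖(ω i).2‖) / 2) ^ 2
        ≤ m * ∑ i, (‖(ω i).1‖ ^ 2 + ‖(ω i).2‖ ^ 2) / 2 := by
      refine sq_sum_le_card_mul_sum_sq.trans ?_
      rw [Finset.card_univ, Fintype.card_fin]
      gcongr with i
      nlinarith [sq_nonneg (‖(ω i).1‖ - ‖(ω i).2‖)]
    rw [hb, div_pow, div_le_iff₀ (by positivity)]
    refine h.trans_eq ?_
    rw [← Finset.sum_div]
    field_simp
  have ha_sq := sq_integral_half_norm_add_norm_le hμ
  rw [← ha] at ha_sq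
  calc _ ≤ (b + a) ^ 2 := by gcongr
    _ ≤ 2 * b ^ 2 + 2 * a ^ 2 := by nlinarith [sq_nonneg (b - a)]
    _ ≤ _ := by linarith

end SpectralKernel

/-- Assume `μ` has finite second moment `σ_p² = E[‖Ω₁‖² + ‖Ω₂‖²]` and the `m ≥ 1`
pairs are sampled i.i.d. from `μ`. For every fixed `(z, z')`, the approximation error
`Δ(z, z') = ⟨φ(z), φ(z')⟩ − K_μ(z, z')` is differentiable in the joint variable `(z, z')`, and
`E[‖∇_{(z,z')} Δ(z, z')‖²] ≤ 8σ_p²`; the squared norm of the joint gradient on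
`ℝ^{2D} ≅ ℝ^D × ℝ^D` is the sum of the squared norms of the two partial gradients. -/
theorem stmt_7 {D : ℕ} {m : ℕ} (hm : 0 < m)
    (μ : Measure (EuclideanSpace ℝ (Fin D) × EuclideanSpace ℝ (Fin D)))
    [IsProbabilityMeasure μ] (σp : ℝ) (hσp : 0 ≤ σp)
    (hmom : Integrable (fun ω : EuclideanSpace ℝ (Fin D) × EuclideanSpace ℝ (Fin D) =>
      ‖ω.1‖ ^ 2 + ‖ω.2‖ ^ 2) μ)
    (hσ : σp ^ 2 = ∫ ω, (‖ω.1‖ ^ 2 + ‖ω.2‖ ^ 2) ∂μ)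
    (z z' : EuclideanSpace ℝ (Fin D)) :
    (∀ ω : Fin m → EuclideanSpace ℝ (Fin D) × EuclideanSpace ℝ (Fin D),
        DifferentiableAt ℝ
          (fun p : EuclideanSpace ℝ (Fin D) × EuclideanSpace ℝ (Fin D) =>
            ⟪featMap ω p.1, featMap ω p.2⟫ - specKernel μ p.1 p.2) (z, z')) ∧
    ∫ ω, (‖gradient (fun y => ⟪featMap ω y, featMap ω z'⟫ - specKernel μ y z') z‖ ^ 2
          + ‖gradient (fun y => ⟪featMap ω z, featMap ω y⟫ - specKernel μ z y) z'‖ ^ 2)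
        ∂(Measure.pi fun _ : Fin m => μ) ≤ 8 * σp ^ 2 := by
  refine ⟨fun ω => ?_, ?_⟩
  · refine .sub ?_ (differentiable_specKernel (integrable_norm_add_norm hmom) _)
    simp only [inner_featMap, div_eq_mul_inv]
    exact (DifferentiableAt.fun_sum fun i _ =>
      differentiable_specPsi (ω i) (z, z')).mul_const (m : ℝ)⁻¹
  have hint (i : Fin m) : Integrable (fun ω : Fin m → _ × _ => ‖(ω i).1‖ ^ 2 + ‖(ω i).2‖ ^ 2)
      (Measure.pi fun _ => μ) :=
    integrable_comp_eval (μ := fun _ : Fin m => μ) (i := i) hmom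
  have hsum := (integrable_finsetSum Finset.univ fun i _ => hint i).div_const (m : ℝ)
  have hm' : (m : ℝ) ≠ 0 := Nat.cast_ne_zero.2 hm.ne'
  calc _ ≤ ∫ ω, 2 * ((∑ i, (‖(ω i).1‖ ^ 2 + ‖(ω i).2‖ ^ 2)) / m + σp ^ 2)
        ∂(Measure.pi fun _ : Fin m => μ) := by
        refine integral_mono_of_nonneg (.of_forall fun ω => by positivity)
          ((hsum.add (integrable_const _)).const_mul 2) (.of_forall fun ω => ?_)
        have h₁ := norm_gradient_sq_le hm hmom ω z z'
        have h₂ := norm_gradient_sq_le hm hmom ω z' z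
        simp only [real_inner_comm (featMap ω z), specKernel_comm _ z] at h₂
        rw [← hσ] at h₁ h₂
        dsimp only
        linarith
    _ = 4 * σp ^ 2 := by
        rw [integral_const_mul, integral_add hsum (integrable_const _), integral_div,
          integral_finsetSum _ fun i _ => hint i]
        have heval (i : Fin m) : ∫ ω, (‖(ω i).1‖ ^ 2 + ‖(ω i).2‖ ^ 2)
            ∂(Measure.pi fun _ : Fin m => μ) = σp ^ 2 :=
          (integral_comp_eval (μ := fun _ : Fin m => μ) (i := i)
            hmom.aestronglyMeasurable).trans hσ.symm
        simp only [heval, Finset.sum_const, Finset.card_univ, Fintype.card_fin, nsmul_eq_mul,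
          integral_const, probReal_univ, one_smul]
        field_simp
        ring
    _ ≤ 8 * σp ^ 2 := by nlinarith [sq_nonneg σp]
end

section
/- For every real x and every y > 0, Σ_{n ∈ ℤ} 1/((x + 2πn)² + y²) = sinh(y) / ( 2y (cosh(y) − cos(x)) ). -/
open Real

lemma summable_inv_add_mul_inv_add (z w : ℂ) :
    Summable fun n : ℤ ↦ ((z + n) * (w + n))⁻¹ := by
  apply EisensteinSeries.summable_inv_of_isBigO_rpow_inv (a := 2) (by norm_num)
  simpa [pow_two, mul_comm] using (EisensteinSeries.linear_inv_isBigO_right 1 z).mul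
    (EisensteinSeries.linear_inv_isBigO_right 1 w)

/-- The Mittag-Leffler expansion of a difference of two cotangents, summed over `ℤ`. -/
lemma hasSum_one_div_add_sub_one_div_add {z w : ℂ} (hz : z ∈ Complex.integerComplement)
    (hw : w ∈ Complex.integerComplement) :
    HasSum (fun n : ℤ ↦ 1 / (w + n) - 1 / (z + n))
      (π * Complex.cot (π * w) - π * Complex.cot (π * z)) := by
  have hs : Summable fun n : ℤ ↦ 1 / (w + n) - 1 / (z + n) := by
    refine ((summable_inv_add_mul_inv_add z w).mul_left (z - w)).congr fun n ↦ ?_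
    have h₁ := Complex.integerComplement_add_ne_zero hz n
    have h₂ := Complex.integerComplement_add_ne_zero hw n
    field_simp
    ring
  have hsymm := tsum_nat_add_neg hs
  rw [hs.nat_add_neg.tsum_eq_zero_add] at hsymm
  have key : ∑' n : ℕ, ((1 / (w - (n + 1)) + 1 / (w + (n + 1))) -
      (1 / (z - (n + 1)) + 1 / (z + (n + 1)))) =
      (π * Complex.cot (π * w) - 1 / w) - (π * Complex.cot (π * z) - 1 / z) := by
    rw [cot_series_rep' hw, cot_series_rep' hz]
    exact (summable_cotTerm hw).tsum_sub (summable_cotTerm hz)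
  have hterm : ∀ n : ℕ, (1 / (w - (n + 1)) + 1 / (w + (n + 1))) -
      (1 / (z - (n + 1)) + 1 / (z + (n + 1))) =
      (1 / (w + ((n + 1 : ℕ) : ℤ)) - 1 / (z + ((n + 1 : ℕ) : ℤ))) +
      (1 / (w + ((-((n + 1 : ℕ) : ℤ) : ℤ) : ℂ)) - 1 / (z + ((-((n + 1 : ℕ) : ℤ) : ℤ) : ℂ))) := by
    intro n
    push_cast
    ring
  rw [tsum_congr hterm] at key
  rw [key] at hsymm
  convert! hs.hasSum using 1
  simp only [Nat.cast_zero, neg_zero, Int.cast_zero, add_zero] at hsymm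
  linear_combination hsymm

lemma mem_integerComplement_of_im_ne_zero {z : ℂ} (hz : z.im ≠ 0) :
    z ∈ Complex.integerComplement := by
  rintro ⟨n, rfl⟩
  simp at hz

lemma Complex.cot_sub_cot {a b : ℂ} (ha : sin a ≠ 0) (hb : sin b ≠ 0) :
    cot a - cot b = 2 * sin (b - a) / (cos (a - b) - cos (a + b)) := by
  have h : cos (a - b) - cos (a + b) = 2 * (sin a * sin b) := by
    rw [cos_sub, cos_add]
    ring
  rw [h, sin_sub, cot, cot]
  field_simp

/-- For every real `x` and every `y > 0`,
`Σ_{n ∈ ℤ} 1/((x + 2πn)² + y²) = sinh(y) / (2y(cosh(y) − cos(x)))`. -/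
theorem stmt_12 (x y : ℝ) (hy : 0 < y) :
    ∑' n : ℤ, 1 / ((x + 2 * Real.pi * n) ^ 2 + y ^ 2) =
      Real.sinh y / (2 * y * (Real.cosh y - Real.cos x)) := by
  have hpi : (π : ℂ) ≠ 0 := by exact_mod_cast Real.pi_ne_zero
  have hy' : (y : ℂ) ≠ 0 := by exact_mod_cast hy.ne'
  have him (s : ℝ) : ((x + s * y * Complex.I) / (2 * π)).im = s * y / (2 * π) := by
    rw [show ((2 : ℂ) * π) = ((2 * π : ℝ) : ℂ) by push_cast; rfl, Complex.div_ofReal_im]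
    simp
  set z : ℂ := (x + (1 : ℝ) * y * Complex.I) / (2 * π) with hzdef
  set w : ℂ := (x + (-1 : ℝ) * y * Complex.I) / (2 * π) with hwdef
  have hz : z ∈ Complex.integerComplement := mem_integerComplement_of_im_ne_zero (by
    rw [him]; have := Real.pi_pos; positivity)
  have hw : w ∈ Complex.integerComplement := mem_integerComplement_of_im_ne_zero (by
    rw [him]
    exact div_ne_zero (by simpa using hy.ne') (by have := Real.pi_pos; positivity))
  have hsum := (hasSum_one_div_add_sub_one_div_add hz hw).mul_left (1 / (4 * π * y * Complex.I))
  rw [← mul_sub, Complex.cot_sub_cot (sin_pi_mul_ne_zero hw) (sin_pi_mul_ne_zero hz),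
    show π * z - π * w = y * Complex.I by rw [hzdef, hwdef]; push_cast; field_simp; ring,
    show π * w - π * z = -(y * Complex.I) by rw [hzdef, hwdef]; push_cast; field_simp; ring,
    show π * w + π * z = x by rw [hzdef, hwdef]; push_cast; field_simp; ring,
    Complex.cos_neg, Complex.cos_mul_I, Complex.sin_mul_I] at hsum
  have hreal : HasSum (fun n : ℤ ↦ ((1 / ((x + 2 * π * n) ^ 2 + y ^ 2) : ℝ) : ℂ))
      ((Real.sinh y / (2 * y * (Real.cosh y - Real.cos x)) : ℝ) : ℂ) := by
    convert! hsum using 1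
    · ext n
      have h₁ := Complex.integerComplement_add_ne_zero hz n
      have h₂ := Complex.integerComplement_add_ne_zero hw n
      have hprod : ((x : ℂ) + 2 * π * n) ^ 2 + y ^ 2 = 4 * π ^ 2 * ((z + n) * (w + n)) := by
        rw [hzdef, hwdef]
        push_cast
        field_simp
        linear_combination 4 * (y : ℂ) ^ 2 * Complex.I_sq
      have hdiff : (z + n) - (w + n) = y * Complex.I / π := by
        rw [hzdef, hwdef]
        push_cast
        field_simp
        ring
      rw [div_sub_div _ _ h₂ h₁, one_mul, mul_one, hdiff]
      push_cast
      rw [hprod]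
      field_simp
    · push_cast
      field_simp
      ring
  exact (Complex.hasSum_ofReal.mp hreal).tsum_eq
end

section
/- Let a > 0, a_1 ≠ 0, and 0 < b_1 < b_2. Define s(u) = a_1/(u² + b_1²) − a_1/(u² + b_2²) and s_a(ω) = (1/a) Σ_{k ∈ ℤ} s((ω + 2πk)/a). Then the function ω ↦ s_a(ω) · (cosh(a b_1) − cos ω)(cosh(a b_2) − cos ω) is not constant on ℝ; equivalently, there is no constant c ∈ ℝ such that s_a(ω) = c / ( (cosh(a b_1) − cos ω)(cosh(a b_2) − cos ω) ) for all ω ∈ ℝ. -/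
open Real

/-- The imaginary part of the cotangent in terms of real and imaginary parts of its argument. -/
lemma Complex.cot_sub_mul_I_im (u v : ℝ) (hv : 0 < v) :
    (Complex.cot (u - v * Complex.I)).im =
      Real.sinh (2 * v) / (Real.cosh (2 * v) - Real.cos (2 * u)) := by
  have hs : Complex.sin (u - v * Complex.I) =
      ⟨Real.sin u * Real.cosh v, -(Real.cos u * Real.sinh v)⟩ := by
    rw [Complex.sin_sub, Complex.cos_mul_I, Complex.sin_mul_I, ← Complex.ofReal_sin,
      ← Complex.ofReal_cos, ← Complex.ofReal_sinh, ← Complex.ofReal_cosh]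
    apply Complex.ext <;> simp [-Complex.ofReal_sin, -Complex.ofReal_cos,
      -Complex.ofReal_sinh, -Complex.ofReal_cosh]
  have hc : Complex.cos (u - v * Complex.I) =
      ⟨Real.cos u * Real.cosh v, Real.sin u * Real.sinh v⟩ := by
    rw [Complex.cos_sub, Complex.cos_mul_I, Complex.sin_mul_I, ← Complex.ofReal_sin,
      ← Complex.ofReal_cos, ← Complex.ofReal_sinh, ← Complex.ofReal_cosh]
    apply Complex.ext <;> simp [-Complex.ofReal_sin, -Complex.ofReal_cos,
      -Complex.ofReal_sinh, -Complex.ofReal_cosh]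
  have hsinh : 0 < Real.sinh v := Real.sinh_pos_iff.2 hv
  have h1 := Real.cosh_sq v
  have h2 := Real.sin_sq_add_cos_sq u
  have hn : Complex.normSq (Complex.sin (u - v * Complex.I)) =
      Real.sin u ^ 2 + Real.sinh v ^ 2 := by
    rw [hs, Complex.normSq_mk]
    linear_combination Real.sin u ^ 2 * h1 + Real.sinh v ^ 2 * h2
  have hpos : 0 < Real.sin u ^ 2 + Real.sinh v ^ 2 := by positivity
  have hden : Real.cosh (2 * v) - Real.cos (2 * u) =
      2 * (Real.sin u ^ 2 + Real.sinh v ^ 2) := by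
    rw [Real.cosh_two_mul, Real.cos_two_mul]
    linear_combination h1 - 2 * h2
  rw [Complex.cot, Complex.div_im, hn, hden, hs, hc, Real.sinh_two_mul]
  field_simp
  linear_combination h2

lemma summable_one_div_add_int_sq_add_sq (x y : ℝ) :
    Summable fun k : ℤ ↦ 1 / ((x + k) ^ 2 + y ^ 2) := by
  have h := (EisensteinSeries.linear_right_summable (x - y * Complex.I) 1 (k := 2) le_rfl).norm
  refine h.congr fun k ↦ ?_
  rw [norm_inv, zpow_ofNat, norm_pow, ← Complex.normSq_eq_norm_sq, Complex.normSq_apply, one_div]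
  simp
  ring

/-- The periodization of a Cauchy density. -/
lemma tsum_one_div_add_int_sq_add_sq (x : ℝ) {y : ℝ} (hy : 0 < y) :
    ∑' k : ℤ, 1 / ((x + k) ^ 2 + y ^ 2) =
      π / y * (Real.sinh (2 * π * y) / (Real.cosh (2 * π * y) - Real.cos (2 * π * x))) := by
  set z : ℂ := x - y * Complex.I with hz
  have hmem : z ∈ Complex.integerComplement := by
    rintro ⟨n, hn⟩
    have := congrArg Complex.im hn
    simp [hz] at this
    exact hy.ne' this
  have him (t : ℝ) : (1 / (z + t)).im = y * (1 / ((x + t) ^ 2 + y ^ 2)) := by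
    simp [hz, Complex.inv_im, Complex.normSq_apply]
    ring
  have hsum := summable_one_div_add_int_sq_add_sq x y
  have hnat := hsum.comp_injective Nat.cast_injective
  have hneg := hsum.comp_injective (i := fun n : ℕ ↦ (-(n + 1 : ℕ) : ℤ)) fun m n h ↦ by
    simpa using h
  have hcot := congrArg Complex.im (cot_series_rep' hmem)
  rw [Complex.im_tsum (summable_cotTerm hmem)] at hcot
  have hterm (n : ℕ) : (1 / (z - (n + 1)) + 1 / (z + (n + 1))).im =
      y * (1 / ((x + ((n + 1 : ℕ) : ℤ)) ^ 2 + y ^ 2) +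
        1 / ((x + ((-(n + 1 : ℕ) : ℤ) : ℝ)) ^ 2 + y ^ 2)) := by
    have h1 := him (n + 1)
    have h2 := him (-(n + 1))
    push_cast at h1 h2 ⊢
    rw [Complex.add_im, h1, sub_eq_add_neg, h2]
    ring
  have hL : (π * Complex.cot (π * z) - 1 / z).im =
      π * (Real.sinh (2 * π * y) / (Real.cosh (2 * π * y) - Real.cos (2 * π * x))) -
        y * (1 / (x ^ 2 + y ^ 2)) := by
    have h0 := him 0
    have harg : (π : ℂ) * z = (π * x : ℝ) - (π * y : ℝ) * Complex.I := by
      rw [hz]; push_cast; ring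
    rw [Complex.ofReal_zero, add_zero, add_zero] at h0
    rw [Complex.sub_im, h0, Complex.im_ofReal_mul, harg,
      Complex.cot_sub_mul_I_im _ _ (by positivity)]
    simp only [mul_assoc]
  simp_rw [hterm] at hcot
  rw [hL, tsum_mul_left] at hcot
  have hnat' := (summable_nat_add_iff 1).2 hnat
  have hsplit := hnat'.tsum_add hneg
  simp only [Function.comp_def] at hsplit hnat hneg
  rw [hsplit] at hcot
  have htot := tsum_of_nat_of_neg_add_one
    (f := fun k : ℤ ↦ 1 / ((x + k) ^ 2 + y ^ 2)) hnat hneg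
  rw [hnat.tsum_eq_zero_add] at htot
  rw [div_mul_eq_mul_div, eq_div_iff hy.ne', htot]
  simp only [Nat.cast_zero, Int.cast_zero, add_zero] at hcot ⊢
  push_cast at hcot ⊢
  linear_combination -hcot

lemma one_div_div_sq_add_sq_eq {a b : ℝ} (ha : 0 < a) (hb : 0 < b) (ω t : ℝ) :
    1 / (((ω + 2 * π * t) / a) ^ 2 + b ^ 2) =
      (a / (2 * π)) ^ 2 * (1 / ((ω / (2 * π) + t) ^ 2 + (a * b / (2 * π)) ^ 2)) := by
  have hπ := Real.pi_pos
  field_simp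

lemma hasSum_one_div_div_sq_add_sq {a b : ℝ} (ha : 0 < a) (hb : 0 < b) (ω : ℝ) :
    HasSum (fun k : ℤ ↦ 1 / (((ω + 2 * π * k) / a) ^ 2 + b ^ 2))
      (a / 2 * (Real.sinh (a * b) / b / (Real.cosh (a * b) - Real.cos ω))) := by
  have hπ := Real.pi_pos
  have hy : 0 < a * b / (2 * π) := by positivity
  have h := ((summable_one_div_add_int_sq_add_sq (ω / (2 * π)) (a * b / (2 * π))).hasSum).mul_left
    ((a / (2 * π)) ^ 2)
  rw [tsum_one_div_add_int_sq_add_sq _ hy, mul_div_cancel₀ (a * b) (by positivity),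
    mul_div_cancel₀ ω (by positivity)] at h
  simp_rw [one_div_div_sq_add_sq_eq ha hb]
  have hval : a / 2 * (Real.sinh (a * b) / b / (Real.cosh (a * b) - Real.cos ω)) =
      (a / (2 * π)) ^ 2 * (π / (a * b / (2 * π)) *
        (Real.sinh (a * b) / (Real.cosh (a * b) - Real.cos ω))) := by
    field_simp
  rwa [hval]

lemma strictConvexOn_sinh : StrictConvexOn ℝ (Set.Ici 0) Real.sinh := by
  refine StrictMonoOn.strictConvexOn_of_deriv (convex_Ici 0) Real.continuous_sinh.continuousOn ?_
  rw [Real.deriv_sinh]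
  exact Real.cosh_strictMonoOn.mono interior_subset

lemma sinh_mul_div_lt_sinh_mul_div {a b₁ b₂ : ℝ} (ha : 0 < a) (hb₁ : 0 < b₁) (hb : b₁ < b₂) :
    Real.sinh (a * b₁) / b₁ < Real.sinh (a * b₂) / b₂ := by
  have hb₂ : 0 < b₂ := hb₁.trans hb
  have h := strictConvexOn_sinh.secant_strict_mono (a := 0) (x := a * b₁) (y := a * b₂)
    Set.self_mem_Ici (by simp; positivity) (by simp; positivity) (by positivity)
    (by positivity) (by gcongr)
  simp only [Real.sinh_zero, sub_zero] at h
  rw [div_lt_div_iff₀ (by positivity) (by positivity)] at h ⊢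
  nlinarith

/-- Let `a > 0`, `a₁ ≠ 0`, and `0 < b₁ < b₂`.  With
`s(u) = a₁/(u² + b₁²) − a₁/(u² + b₂²)` and `s_a(ω) = (1/a) Σ_{k ∈ ℤ} s((ω + 2πk)/a)`,
there is no constant `c ∈ ℝ` such that
`s_a(ω) = c / ((cosh(ab₁) − cos ω)(cosh(ab₂) − cos ω))` for all `ω ∈ ℝ`; equivalently, the
function `ω ↦ s_a(ω)·(cosh(ab₁) − cos ω)(cosh(ab₂) − cos ω)` is not constant on `ℝ`. -/
theorem stmt_16 (a a₁ b₁ b₂ : ℝ) (ha : 0 < a) (ha₁ : a₁ ≠ 0)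
    (hb₁ : 0 < b₁) (hb : b₁ < b₂) :
    ¬ ∃ c : ℝ, ∀ ω : ℝ,
      (1 / a) * ∑' k : ℤ,
          (a₁ / (((ω + 2 * Real.pi * k) / a) ^ 2 + b₁ ^ 2) -
            a₁ / (((ω + 2 * Real.pi * k) / a) ^ 2 + b₂ ^ 2)) =
        c / ((Real.cosh (a * b₁) - Real.cos ω) * (Real.cosh (a * b₂) - Real.cos ω)) := by
  rintro ⟨c, hc⟩
  have hb₂ : 0 < b₂ := hb₁.trans hb
  have hlt := sinh_mul_div_lt_sinh_mul_div ha hb₁ hb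
  set S₁ := Real.sinh (a * b₁) / b₁ with hS₁
  set S₂ := Real.sinh (a * b₂) / b₂ with hS₂
  have key (ω : ℝ) : a₁ / 2 *
      (S₁ * (Real.cosh (a * b₂) - Real.cos ω) - S₂ * (Real.cosh (a * b₁) - Real.cos ω)) = c := by
    have h₁ : 0 < Real.cosh (a * b₁) - Real.cos ω :=
      sub_pos.2 ((Real.cos_le_one ω).trans_lt (Real.one_lt_cosh.2 (by positivity)))
    have h₂ : 0 < Real.cosh (a * b₂) - Real.cos ω :=
      sub_pos.2 ((Real.cos_le_one ω).trans_lt (Real.one_lt_cosh.2 (by positivity)))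
    have hsum := ((hasSum_one_div_div_sq_add_sq ha hb₁ ω).mul_left a₁).sub
      ((hasSum_one_div_div_sq_add_sq ha hb₂ ω).mul_left a₁)
    simp only [mul_one_div] at hsum
    have h := hc ω
    rw [hsum.tsum_eq, ← hS₁, ← hS₂, eq_div_iff (by positivity)] at h
    rw [← h]
    field_simp
  have h0 := key 0
  have hπ := key π
  rw [Real.cos_zero] at h0
  rw [Real.cos_pi] at hπ
  have : a₁ * (S₂ - S₁) = 0 := by linear_combination h0 - hπ
  rcases mul_eq_zero.1 this with h | h
  · exact ha₁ h
  · linarith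
end
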